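/- arXiv:1612.05567 — 4 statements merged into one kernel-verified Lean document; each statement's English description precedes it below -/
import Mathlib

section
/- Let 𝐀 be a BBL transformation of bandwidth (p,q) on V_d^S. Then for all −∞ ≤ L̃ ≤ L ≤ R ≤ R̃ ≤ ∞ with L and R finite, the nesting property P_{L,R} M_{L̃,R̃} ⊆ M_{L,R} holds; in particular, P_{L,R} Ker 𝐀 ⊆ M_{L,R}. -/
noncomputable section

/-- The space of doubly-infinite sequences with values in `ℂ^d`. -/
abbrev SeqSp (d : ℕ) : Type := ℤ → Fin d → ℂ

/-- The shift `(Ψ_j)_j ↦ (Ψ_{j+n})_j`; for `n = 1` this is the left shift `T`. -/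
def shiftBy (d : ℕ) (n : ℤ) : Module.End ℂ (SeqSp d) where
  toFun Ψ := fun j => Ψ (j + n)
  map_add' _ _ := rfl
  map_smul' _ _ := rfl

/-- Entrywise multiplication of a sequence by a fixed `d × d` matrix. -/
def matOp (d : ℕ) (m : Matrix (Fin d) (Fin d) ℂ) : Module.End ℂ (SeqSp d) where
  toFun Ψ := fun j => m.mulVec (Ψ j)
  map_add' Ψ Φ := by funext j; simp [Matrix.mulVec_add]
  map_smul' c Ψ := by funext j; simp [Matrix.mulVec_smul]

/-- The banded block-Laurent (BBL) transformation `(𝐀Ψ)_j = ∑_{r=p}^{q} a_r ψ_{j+r}`. -/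
def bbl (d : ℕ) (a : ℤ → Matrix (Fin d) (Fin d) ℂ) (p q : ℤ) : Module.End ℂ (SeqSp d) :=
  ∑ r ∈ Finset.Icc p q, matOp d (a r) * shiftBy d r

/-- The projection `P_S` replacing every entry with index outside `S` by zero. -/
def projOn (d : ℕ) (S : Set ℤ) : Module.End ℂ (SeqSp d) where
  toFun Ψ := fun j => S.indicator Ψ j
  map_add' Ψ Φ := by
    funext j
    by_cases h : j ∈ S <;> simp [Set.indicator_apply, h]
  map_smul' c Ψ := by
    funext j
    by_cases h : j ∈ S <;> simp [Set.indicator_apply, h]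

/-- The window `{j : ℤ | Lb ≤ j ≤ Rb}`, with possibly infinite endpoints. -/
def windowSet (Lb : WithBot ℤ) (Rb : WithTop ℤ) : Set ℤ :=
  {j : ℤ | Lb ≤ (j : WithBot ℤ) ∧ (j : WithTop ℤ) ≤ Rb}

/-- Sequences supported in `S` (vanishing at every index outside `S`): the space `V_{L,R}`. -/
def suppIn (d : ℕ) (S : Set ℤ) : Submodule ℂ (SeqSp d) where
  carrier := {Ψ | ∀ j ∉ S, Ψ j = 0}
  add_mem' := by
    intro Ψ Φ hΨ hΦ j hj
    simp [Pi.add_apply, hΨ j hj, hΦ j hj]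
  zero_mem' := fun j _ => rfl
  smul_mem' := by
    intro c Ψ hΨ j hj
    simp [Pi.smul_apply, hΨ j hj]

/-- Sequences vanishing at every index of `S`. -/
def vanishOn (d : ℕ) (S : Set ℤ) : Submodule ℂ (SeqSp d) where
  carrier := {Ψ | ∀ j ∈ S, Ψ j = 0}
  add_mem' := by
    intro Ψ Φ hΨ hΦ j hj
    simp [Pi.add_apply, hΨ j hj, hΦ j hj]
  zero_mem' := fun j _ => rfl
  smul_mem' := by
    intro c Ψ hΨ j hj
    simp [Pi.smul_apply, hΨ j hj]

/-- The bulk solution space `M_{Lb,Rb} = Ker (P_{Lb−p',Rb−q'} 𝐀 |_{V_{Lb,Rb}})`, viewed as a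
submodule of the full sequence space: sequences supported in the window `[Lb,Rb]` whose image
under `𝐀` vanishes on the bulk window `[Lb−p', Rb−q']` (with `p' = min p 0`, `q' = max q 0`). -/
def bulkSol (d : ℕ) (a : ℤ → Matrix (Fin d) (Fin d) ℂ) (p q : ℤ)
    (Lb : WithBot ℤ) (Rb : WithTop ℤ) : Submodule ℂ (SeqSp d) :=
  suppIn d (windowSet Lb Rb) ⊓
    (vanishOn d (windowSet (Lb + ((-min p 0 : ℤ) : WithBot ℤ))
        (Rb + ((-max q 0 : ℤ) : WithTop ℤ)))).comap (bbl d a p q)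

/-- Falling-factorial type product `j^{(v)} = (j−v+1)(j−v+2)⋯j`. -/
def ff (j : ℤ) (v : ℕ) : ℤ := ∏ i ∈ Finset.range v, (j - i)

/-- The scalar sequence `Φ_{z,v}`, with `j`-th entry `j^{(v−1)} z^{j−v+1}`, and `Φ_{z,0} = 0`. -/
def Phi (z : ℂ) (v : ℕ) : ℤ → ℂ :=
  fun j => if v = 0 then 0 else (ff j (v - 1) : ℂ) * z ^ (j - (v : ℤ) + 1)

/-- The vector sequence `Φ_{z,v}|m⟩`. -/
def PhiVec (d : ℕ) (z : ℂ) (v : ℕ) (m : Fin d) : SeqSp d :=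
  fun j => Phi z v j • (Pi.single m 1 : Fin d → ℂ)

/-- The subspace `T_{z,s} = Span{Φ_{z,v}|m⟩ : 1 ≤ v ≤ s, 1 ≤ m ≤ d}`. -/
def Tspace (d : ℕ) (z : ℂ) (s : ℕ) : Submodule ℂ (SeqSp d) :=
  Submodule.span ℂ {Ψ : SeqSp d | ∃ v ∈ Finset.Icc 1 s, ∃ m : Fin d, Ψ = PhiVec d z v m}

/-- The symbol `A(w,w⁻¹) = ∑_{r=p}^q w^r a_r` as a matrix of Laurent polynomials. -/
def symbol (d : ℕ) (a : ℤ → Matrix (Fin d) (Fin d) ℂ) (p q : ℤ) :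
    Matrix (Fin d) (Fin d) (LaurentPolynomial ℂ) :=
  ∑ r ∈ Finset.Icc p q, (LaurentPolynomial.T r : LaurentPolynomial ℂ) • (a r).map (fun c => LaurentPolynomial.C c)

/-- The evaluation `A(z,z⁻¹) = ∑_{r=p}^q z^r a_r` of the symbol at `z ≠ 0`. -/
def symbolEval (d : ℕ) (a : ℤ → Matrix (Fin d) (Fin d) ℂ) (p q : ℤ) (z : ℂ) :
    Matrix (Fin d) (Fin d) ℂ :=
  ∑ r ∈ Finset.Icc p q, z ^ r • a r

/-- The `k`-th derivative `A^{(k)}(z,z⁻¹) = ∑_{r=p}^q r(r−1)⋯(r−k+1) z^{r−k} a_r`. -/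
def symbolDeriv (d : ℕ) (a : ℤ → Matrix (Fin d) (Fin d) ℂ) (p q : ℤ) (k : ℕ) (z : ℂ) :
    Matrix (Fin d) (Fin d) ℂ :=
  ∑ r ∈ Finset.Icc p q, ((ff r k : ℂ) * z ^ (r - (k : ℤ))) • a r

/-- The generalized kernel `⋃_k Ker (f^k)` of an endomorphism. -/
def genKer (d : ℕ) (f : Module.End ℂ (SeqSp d)) : Submodule ℂ (SeqSp d) :=
  ⨆ k : ℕ, LinearMap.ker (f ^ k)

/-- `F_L^− `: the generalized kernel of the unilateral shift `P_{L,∞}T` on `M_{L,∞}`. -/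
def Fminus (d : ℕ) (a : ℤ → Matrix (Fin d) (Fin d) ℂ) (p q : ℤ) (L : ℤ) :
    Submodule ℂ (SeqSp d) :=
  bulkSol d a p q (L : WithBot ℤ) ⊤ ⊓
    genKer d (projOn d (windowSet (L : WithBot ℤ) ⊤) * shiftBy d 1)

/-- `F_R^+`: the generalized kernel of the shift `P_{−∞,R}T⁻¹` on `M_{−∞,R}`. -/
def Fplus (d : ℕ) (a : ℤ → Matrix (Fin d) (Fin d) ℂ) (p q : ℤ) (R : ℤ) :
    Submodule ℂ (SeqSp d) :=
  bulkSol d a p q ⊥ (R : WithTop ℤ) ⊓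
    genKer d (projOn d (windowSet ⊥ (R : WithTop ℤ)) * shiftBy d (-1))

/-- The left shift on scalar sequences. -/
def shiftS : Module.End ℂ (ℤ → ℂ) where
  toFun φ := fun j => φ (j + 1)
  map_add' _ _ := rfl
  map_smul' _ _ := rfl

/-- The linear map on `SeqSp d` induced by a diagonal matrix polynomial with diagonal entries
`g m`: it acts on the `m`-th component of a sequence as `g m` evaluated at the left shift. -/
def diagPolyOp (d : ℕ) (g : Fin d → Polynomial ℂ) : Module.End ℂ (SeqSp d) where
  toFun Ψ := fun j m => Polynomial.aeval shiftS (g m) (fun i => Ψ i m) j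
  map_add' Ψ Φ := by
    funext j m
    show Polynomial.aeval shiftS (g m) ((fun i => Ψ i m) + (fun i => Φ i m)) j = _
    rw [map_add]
    rfl
  map_smul' c Ψ := by
    funext j m
    show Polynomial.aeval shiftS (g m) (c • (fun i => Ψ i m)) j = _
    rw [map_smul]
    rfl

/-- The subspace of sequences with values in `Span{|m⟩ : d₀ < m ≤ d}` (the range of `ρ_d(π)`). -/
def piRange (d d₀ : ℕ) : Submodule ℂ (SeqSp d) where
  carrier := {Ψ | ∀ j : ℤ, ∀ m : Fin d, (m : ℕ) < d₀ → Ψ j m = 0}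
  add_mem' := by
    intro Ψ Φ hΨ hΦ j m hm
    simp [Pi.add_apply, hΨ j m hm, hΦ j m hm]
  zero_mem' := fun j m _ => rfl
  smul_mem' := by
    intro c Ψ hΨ j m hm
    simp [Pi.smul_apply, hΨ j m hm]

/-- The Hilbert space `H` of square-summable half-infinite sequences, as a subspace of `SeqSp d`:
sequences vanishing at indices `j ≤ 0` whose restriction to `j ≥ 1` is in `ℓ²`. -/
def Hspace (d : ℕ) : Submodule ℂ (SeqSp d) where
  carrier := {Ψ | (∀ j : ℤ, j ≤ 0 → Ψ j = 0) ∧ Memℓp (fun n : ℕ => Ψ ((n : ℤ) + 1)) 2}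
  add_mem' := by
    intro Ψ Φ hΨ hΦ
    refine ⟨fun j hj => by simp [Pi.add_apply, hΨ.1 j hj, hΦ.1 j hj], ?_⟩
    exact hΨ.2.add hΦ.2
  zero_mem' := ⟨fun j _ => rfl, zero_memℓp⟩
  smul_mem' := by
    intro c Ψ hΨ
    exact ⟨fun j hj => by simp [Pi.smul_apply, hΨ.1 j hj], hΨ.2.const_smul c⟩


theorem bbl_apply (d : ℕ) (a : ℤ → Matrix (Fin d) (Fin d) ℂ) (p q : ℤ) (Ψ : SeqSp d) (j : ℤ) :
    bbl d a p q Ψ j = ∑ r ∈ Finset.Icc p q, (a r).mulVec (Ψ (j + r)) := by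
  simp [bbl, LinearMap.sum_apply, Finset.sum_apply, matOp, shiftBy]

theorem mem_windowSet_coe {L R j : ℤ} :
    j ∈ windowSet (L : WithBot ℤ) (R : WithTop ℤ) ↔ L ≤ j ∧ j ≤ R := by
  simp [windowSet]

theorem windowSet_mono {L L' : WithBot ℤ} {R R' : WithTop ℤ} (hL : L' ≤ L) (hR : R ≤ R') :
    windowSet L R ⊆ windowSet L' R' :=
  fun _ hj => ⟨hL.trans hj.1, hj.2.trans hR⟩

/-- On the bulk of a finite window, truncating a sequence to the window does not affect its image
under a BBL transformation. -/
theorem bbl_projOn_apply (d : ℕ) (a : ℤ → Matrix (Fin d) (Fin d) ℂ) (p q : ℤ) (Ψ : SeqSp d)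
    {L R j : ℤ} (hjL : L - min p 0 ≤ j) (hjR : j ≤ R - max q 0) :
    bbl d a p q (projOn d (windowSet (L : WithBot ℤ) (R : WithTop ℤ)) Ψ) j =
      bbl d a p q Ψ j := by
  rw [bbl_apply, bbl_apply]
  refine Finset.sum_congr rfl fun r hr => ?_
  rw [Finset.mem_Icc] at hr
  have h : j + r ∈ windowSet (L : WithBot ℤ) (R : WithTop ℤ) :=
    mem_windowSet_coe.2 ⟨by omega, by omega⟩
  exact congrArg _ (Set.indicator_of_mem h Ψ)

/-- The truncation of `Ψ` to a finite window is a bulk solution as soon as the image of `Ψ` under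
the BBL transformation vanishes on the bulk of that window. -/
theorem projOn_mem_bulkSol (d : ℕ) (a : ℤ → Matrix (Fin d) (Fin d) ℂ) (p q L R : ℤ) (Ψ : SeqSp d)
    (hΨ : bbl d a p q Ψ ∈ vanishOn d (windowSet ((L : WithBot ℤ) + ((-min p 0 : ℤ) : WithBot ℤ))
      ((R : WithTop ℤ) + ((-max q 0 : ℤ) : WithTop ℤ)))) :
    projOn d (windowSet (L : WithBot ℤ) (R : WithTop ℤ)) Ψ ∈
      bulkSol d a p q (L : WithBot ℤ) (R : WithTop ℤ) := by
  refine ⟨fun j hj => Set.indicator_of_notMem hj Ψ, fun j hj => ?_⟩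
  have hj' := hj
  rw [← WithBot.coe_add, ← WithTop.coe_add, mem_windowSet_coe] at hj'
  rw [bbl_projOn_apply d a p q Ψ (by omega) (by omega)]
  exact hΨ j hj

theorem stmt_1 (d : ℕ) (hd : 1 ≤ d) (p q : ℤ) (hpq : p ≤ q)
    (a : ℤ → Matrix (Fin d) (Fin d) ℂ) (hap : a p ≠ 0) (haq : a q ≠ 0)
    (L R : ℤ) (hLR : L ≤ R)
    (Lt : WithBot ℤ) (Rt : WithTop ℤ) (hL : Lt ≤ (L : WithBot ℤ)) (hR : (R : WithTop ℤ) ≤ Rt) :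
    (bulkSol d a p q Lt Rt).map (projOn d (windowSet (L : WithBot ℤ) (R : WithTop ℤ)))
        ≤ bulkSol d a p q (L : WithBot ℤ) (R : WithTop ℤ) ∧
    (LinearMap.ker (bbl d a p q)).map (projOn d (windowSet (L : WithBot ℤ) (R : WithTop ℤ)))
        ≤ bulkSol d a p q (L : WithBot ℤ) (R : WithTop ℤ) := by
  constructor
  · rintro _ ⟨Ψ, hΨ, rfl⟩
    exact projOn_mem_bulkSol d a p q L R Ψ fun j hj =>
      hΨ.2 j (windowSet_mono (by gcongr) (by gcongr) hj)
  · rintro _ ⟨Ψ, hΨ, rfl⟩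
    exact projOn_mem_bulkSol d a p q L R Ψ fun j _ => congrFun (LinearMap.mem_ker.1 hΨ) j

end
end

section
/- Let 𝐀 be a BBL transformation of bandwidth (p,q) on V_d^S with symbol A(w,w⁻¹), let z ∈ ℂ∖{0} and s ≥ 1, and let T_{z,s} = Span{Φ_{z,v}|m⟩ : 1 ≤ v ≤ s, 1 ≤ m ≤ d} = Ker((T − z)^s) ⊆ V_d^S. Then T_{z,s} is invariant under 𝐀, and for every Ψ = Σ_{v=1}^{s} Φ_{z,v} |ψ_v⟩ ∈ T_{z,s} one has 𝐀Ψ = Σ_{x=1}^{s} Φ_{z,x} |χ_x⟩ with |χ_x⟩ = Σ_{v=x}^{s} C(v−1, x−1) A^{(v−x)}(z, z⁻¹) |ψ_v⟩, where C(·,·) is the binomial coefficient and A^{(k)}(z,z⁻¹) = Σ_{r=p}^{q} (d^k/dz^k)(z^r) a_r is the k-th derivative of the symbol evaluated at z. -/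
noncomputable section

theorem ff_eq_smeval_descPochhammer (j : ℤ) (n : ℕ) :
    ff j n = (descPochhammer ℤ n).smeval j := by
  rw [← Polynomial.eval_eq_smeval, descPochhammer_eval_eq_prod_range, ff]

/-- The Chu–Vandermonde identity for falling factorials. -/
theorem ff_add (j r : ℤ) (n : ℕ) :
    ff (j + r) n = ∑ k ∈ Finset.range (n + 1), (n.choose k : ℤ) * (ff j k * ff r (n - k)) := by
  simp only [ff_eq_smeval_descPochhammer]
  rw [Ring.descPochhammer_smeval_add n (Commute.all j r),
    Finset.Nat.sum_antidiagonal_eq_sum_range_succ_mk]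

/-- The translate of `Φ_{z,v}` by `r`, expanded along the `Φ_{z,x}` with `x ≤ v`. -/
theorem Phi_add {z : ℂ} (hz : z ≠ 0) {v : ℕ} (hv : 1 ≤ v) (j r : ℤ) :
    Phi z v (j + r) = ∑ x ∈ Finset.Icc 1 v, Phi z x j *
      (((v - 1).choose (x - 1) : ℂ) * ((ff r (v - x) : ℂ) * z ^ (r - ((v - x : ℕ) : ℤ)))) := by
  obtain ⟨n, rfl⟩ := Nat.exists_eq_add_of_le' hv
  rw [← Finset.Ico_add_one_right_eq_Icc, Finset.sum_Ico_eq_sum_range]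
  simp only [Phi, Nat.add_sub_cancel, Nat.add_eq_zero_iff, one_ne_zero, false_and, and_false,
    if_false, Nat.add_sub_cancel_left, ff_add j r n]
  push_cast
  rw [Finset.sum_mul]
  refine Finset.sum_congr rfl fun k hk => ?_
  have hkn : k ≤ n := Nat.lt_succ_iff.mp (Finset.mem_range.mp hk)
  have hsub : n + 1 - (1 + k) = n - k := by omega
  have hexp : j + r - ((n : ℤ) + 1) + 1 = (j - (1 + (k : ℤ)) + 1) + (r - ((n - k : ℕ) : ℤ)) := by
    omega
  rw [hsub, hexp, zpow_add₀ hz]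
  ring

theorem bbl_Phi_smul (d : ℕ) (a : ℤ → Matrix (Fin d) (Fin d) ℂ) (p q : ℤ) {z : ℂ} (hz : z ≠ 0)
    {v : ℕ} (hv : 1 ≤ v) (u : Fin d → ℂ) (j : ℤ) :
    bbl d a p q (fun i => Phi z v i • u) j = ∑ x ∈ Finset.Icc 1 v, Phi z x j •
      ((v - 1).choose (x - 1) : ℂ) • (symbolDeriv d a p q (v - x) z).mulVec u := by
  simp only [bbl_apply, Phi_add hz hv, symbolDeriv, Matrix.mulVec_smul, Matrix.sum_mulVec,
    Matrix.mulVec_sum, Matrix.smul_mulVec, Finset.sum_smul, Finset.smul_sum, smul_smul]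
  exact Finset.sum_comm

theorem bbl_sum_Phi_smul (d : ℕ) (a : ℤ → Matrix (Fin d) (Fin d) ℂ) (p q : ℤ) {z : ℂ}
    (hz : z ≠ 0) (s : ℕ) (ψ : ℕ → Fin d → ℂ) :
    bbl d a p q (fun j => ∑ v ∈ Finset.Icc 1 s, Phi z v j • ψ v) =
      fun j => ∑ x ∈ Finset.Icc 1 s, Phi z x j •
        ∑ v ∈ Finset.Icc x s, (((v - 1).choose (x - 1) : ℕ) : ℂ) •
          (symbolDeriv d a p q (v - x) z).mulVec (ψ v) := by
  have hsum : (fun j => ∑ v ∈ Finset.Icc 1 s, Phi z v j • ψ v) =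
      ∑ v ∈ Finset.Icc 1 s, (fun j => Phi z v j • ψ v : SeqSp d) := by
    funext j
    rw [Finset.sum_apply]
  funext j
  rw [hsum, map_sum, Finset.sum_apply, Finset.sum_congr rfl fun v hv =>
    bbl_Phi_smul d a p q hz (Finset.mem_Icc.mp hv).1 (ψ v) j]
  simp only [Finset.smul_sum]
  refine Finset.sum_comm' fun v x => ?_
  simp only [Finset.mem_Icc]
  omega

theorem Phi_smul_mem_Tspace {d : ℕ} (z : ℂ) {s v : ℕ} (hv : v ∈ Finset.Icc 1 s)
    (u : Fin d → ℂ) : (fun j => Phi z v j • u : SeqSp d) ∈ Tspace d z s := by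
  have h : (fun j => Phi z v j • u : SeqSp d) = ∑ m, u m • PhiVec d z v m := by
    funext j k
    simp [PhiVec, Finset.sum_apply, Pi.single_apply, mul_comm]
  rw [h]
  exact Submodule.sum_mem _ fun m _ =>
    Submodule.smul_mem _ _ (Submodule.subset_span ⟨v, hv, m, rfl⟩)

theorem bbl_mem_Tspace (d : ℕ) (a : ℤ → Matrix (Fin d) (Fin d) ℂ) (p q : ℤ) {z : ℂ}
    (hz : z ≠ 0) {s : ℕ} {Ψ : SeqSp d} (hΨ : Ψ ∈ Tspace d z s) :
    bbl d a p q Ψ ∈ Tspace d z s := by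
  suffices h : Tspace d z s ≤ (Tspace d z s).comap (bbl d a p q) from h hΨ
  refine Submodule.span_le.mpr ?_
  rintro _ ⟨v, hv, m, rfl⟩
  obtain ⟨hv1, hvs⟩ := Finset.mem_Icc.mp hv
  have h : bbl d a p q (PhiVec d z v m) = ∑ x ∈ Finset.Icc 1 v, (fun j => Phi z x j •
      ((v - 1).choose (x - 1) : ℂ) •
        (symbolDeriv d a p q (v - x) z).mulVec (Pi.single m 1) : SeqSp d) := by
    funext j
    rw [Finset.sum_apply]
    exact bbl_Phi_smul d a p q hz hv1 (Pi.single m 1) j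
  rw [SetLike.mem_coe, Submodule.mem_comap, h]
  exact Submodule.sum_mem _ fun x hx =>
    Phi_smul_mem_Tspace z (Finset.Icc_subset_Icc_right hvs hx) _

theorem stmt_7 (d : ℕ) (hd : 1 ≤ d) (p q : ℤ) (hpq : p ≤ q)
    (a : ℤ → Matrix (Fin d) (Fin d) ℂ)
    (z : ℂ) (hz : z ≠ 0) (s : ℕ) (hs : 1 ≤ s) :
    (∀ Ψ ∈ Tspace d z s, bbl d a p q Ψ ∈ Tspace d z s) ∧
    (∀ ψ : ℕ → Fin d → ℂ,
      bbl d a p q (fun j => ∑ v ∈ Finset.Icc 1 s, Phi z v j • ψ v) =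
        fun j => ∑ x ∈ Finset.Icc 1 s, Phi z x j •
          ∑ v ∈ Finset.Icc x s, (((v - 1).choose (x - 1) : ℕ) : ℂ) •
            (symbolDeriv d a p q (v - x) z).mulVec (ψ v)) :=
  ⟨fun _ hΨ => bbl_mem_Tspace d a p q hz hΨ, bbl_sum_Phi_smul d a p q hz s⟩

end
end

section
/- Let D(w) be a d×d diagonal matrix polynomial with diagonal entries g_1(w), …, g_{d₀}(w), 0, …, 0 (0 ≤ d₀ ≤ d), where each g_m is monic and factors as g_m(w) = w^{s_{m0}} Π_{ℓ=1}^{n} (w − z_ℓ)^{s_{mℓ}} with z_1, …, z_n distinct nonzero complex numbers and s_{mℓ} ≥ 0. Let 𝐃 be the linear transformation of V_d^S induced by D, and let π = Σ_{m=d₀+1}^{d} |m⟩⟨m| act entrywise on sequences. Then Ker 𝐃 = W_D ⊕ Range(ρ_d(π)), where W_D = Span{Φ_{z_ℓ,v}|m⟩ : 1 ≤ m ≤ d₀, 1 ≤ ℓ ≤ n, 1 ≤ v ≤ s_{mℓ}} and Range(ρ_d(π)) is the subspace of sequences whose entries take values in Span{|m⟩ : d₀ < m ≤ d}. -/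
noncomputable section

/-- The space `W_D`. -/
def WD (d d₀ n : ℕ) (z : Fin n → ℂ) (smult : Fin d → Fin n → ℕ) : Submodule ℂ (SeqSp d) :=
  Submodule.span ℂ {Ψ : SeqSp d | ∃ m : Fin d, (m : ℕ) < d₀ ∧
    ∃ ℓ : Fin n, ∃ v ∈ Finset.Icc 1 (smult m ℓ), Ψ = PhiVec d (z ℓ) v m}

theorem ff_succ_right (j : ℤ) (k : ℕ) : ff j (k + 1) = ff j k * (j - k) := by
  simp [ff, Finset.prod_range_succ]

theorem ff_succ_succ (j : ℤ) (k : ℕ) : ff (j + 1) (k + 1) = (j + 1) * ff j k := by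
  simp [ff, Finset.prod_range_succ', mul_comm]

theorem aeval_shiftS_X_sub_C (z : ℂ) (φ : ℤ → ℂ) (j : ℤ) :
    Polynomial.aeval shiftS (Polynomial.X - Polynomial.C z) φ j = φ (j + 1) - z * φ j := by
  simp [shiftS, Module.algebraMap_end_apply]

theorem aeval_shiftS_X_sub_C_Phi_succ {z : ℂ} (hz : z ≠ 0) (v : ℕ) :
    Polynomial.aeval shiftS (Polynomial.X - Polynomial.C z) (Phi z (v + 1))
      = (v : ℂ) • Phi z v := by
  funext j
  rw [aeval_shiftS_X_sub_C]
  rcases v with _ | k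
  · simp [Phi, ff, zpow_add_one₀ hz, mul_comm]
  · have h1 : z ^ (j + 1 - ((k + 1 + 1 : ℕ) : ℤ) + 1) = z ^ (j - ((k + 1 : ℕ) : ℤ) + 1) := by
      congr 1; push_cast; ring
    have h2 : z * z ^ (j - ((k + 1 + 1 : ℕ) : ℤ) + 1) = z ^ (j - ((k + 1 : ℕ) : ℤ) + 1) := by
      rw [← zpow_one_add₀ hz]; congr 1; push_cast; ring
    simp only [Phi, Pi.smul_apply, smul_eq_mul, Nat.succ_ne_zero, if_false, Nat.add_sub_cancel, h1]
    rw [mul_left_comm z, h2, ff_succ_succ, ff_succ_right]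
    push_cast
    ring

/-- Kernel of `T - z` for the scalar shift `T`: the multiples of `Φ_{z,1}`. -/
theorem eq_smul_Phi_one {z : ℂ} (hz : z ≠ 0) {φ : ℤ → ℂ}
    (h : Polynomial.aeval shiftS (Polynomial.X - Polynomial.C z) φ = 0) :
    φ = φ 0 • Phi z 1 := by
  have step (j : ℤ) : φ (j + 1) = z * φ j := by
    have := congrFun h j
    rw [aeval_shiftS_X_sub_C] at this
    exact sub_eq_zero.mp this
  have key (j : ℤ) : φ j = φ 0 * z ^ j := by
    induction j using Int.induction_on with
    | zero => simp
    | succ i ih => rw [step, ih, zpow_add_one₀ hz]; ring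
    | pred i ih =>
      have hs := step (-(i : ℤ) - 1)
      rw [sub_add_cancel, ih] at hs
      rw [zpow_sub_one₀ hz, ← mul_assoc, hs, mul_right_comm, mul_inv_cancel₀ hz, one_mul]
  funext j
  simpa [Phi, ff] using key j

/-- The span of `Φ_{z,1}, …, Φ_{z,s}`. -/
def PhiSpan (z : ℂ) (s : ℕ) : Submodule ℂ (ℤ → ℂ) :=
  Submodule.span ℂ (Phi z '' Finset.Icc 1 s)

theorem Phi_mem_PhiSpan (z : ℂ) {v s : ℕ} (h : v ≤ s) : Phi z v ∈ PhiSpan z s := by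
  rcases v.eq_zero_or_pos with rfl | hv
  · have : Phi z 0 = 0 := by funext j; simp [Phi]
    rw [this]
    exact zero_mem _
  · exact Submodule.subset_span ⟨v, by simpa using ⟨hv, h⟩, rfl⟩

theorem ker_aeval_shiftS_X_sub_C_pow {z : ℂ} (hz : z ≠ 0) (s : ℕ) :
    LinearMap.ker (Polynomial.aeval shiftS ((Polynomial.X - Polynomial.C z) ^ s))
      = PhiSpan z s := by
  induction s with
  | zero => simp [PhiSpan, Module.End.one_eq_id]
  | succ s ih =>
    set N := Polynomial.aeval shiftS (Polynomial.X - Polynomial.C z) with hN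
    have hker : LinearMap.ker (Polynomial.aeval shiftS ((Polynomial.X - Polynomial.C z) ^ (s + 1)))
        = (PhiSpan z s).comap N := by
      rw [← ih, pow_succ, map_mul, Module.End.mul_eq_comp, LinearMap.ker_comp]
    rw [hker]
    apply le_antisymm
    · intro φ hφ
      have hle : PhiSpan z s ≤ (PhiSpan z (s + 1)).map N := by
        rw [PhiSpan, Submodule.span_le]
        rintro _ ⟨v, hv, rfl⟩
        have hv := Finset.mem_Icc.mp hv
        refine ⟨(v : ℂ)⁻¹ • Phi z (v + 1),
          Submodule.smul_mem _ _ (Phi_mem_PhiSpan z (by lia)), ?_⟩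
        rw [map_smul, aeval_shiftS_X_sub_C_Phi_succ hz, inv_smul_smul₀]
        exact Nat.cast_ne_zero.mpr (by lia)
      obtain ⟨χ, hχ, hχφ⟩ := hle hφ
      have hdiff := eq_smul_Phi_one hz (φ := φ - χ) (by rw [map_sub, ← hN, hχφ, sub_self])
      rw [← sub_add_cancel φ χ, hdiff]
      exact add_mem (Submodule.smul_mem _ _ (Phi_mem_PhiSpan z (by lia))) hχ
    · rw [PhiSpan, Submodule.span_le]
      rintro _ ⟨v, hv, rfl⟩
      have hv := Finset.mem_Icc.mp hv
      obtain ⟨k, rfl⟩ := Nat.exists_eq_add_of_le' hv.1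
      change N (Phi z (k + 1)) ∈ PhiSpan z s
      rw [hN, aeval_shiftS_X_sub_C_Phi_succ hz]
      exact Submodule.smul_mem _ _ (Phi_mem_PhiSpan z (by lia))

theorem ker_aeval_prod_of_pairwise_isCoprime {R M ι : Type*} [CommRing R] [AddCommGroup M]
    [Module R M] (f : Module.End R M) (p : ι → Polynomial R)
    (hp : Pairwise (Function.onFun IsCoprime p)) (t : Finset ι) :
    LinearMap.ker (Polynomial.aeval f (∏ i ∈ t, p i))
      = ⨆ i ∈ t, LinearMap.ker (Polynomial.aeval f (p i)) := by
  classical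
  induction t using Finset.induction_on with
  | empty => simp [Module.End.one_eq_id]
  | insert a t ha ih =>
    rw [Finset.prod_insert ha, Finset.iSup_insert, ← ih,
      Polynomial.sup_ker_aeval_eq_ker_aeval_mul_of_coprime]
    exact IsCoprime.prod_right fun i hi => hp (ne_of_mem_of_not_mem hi ha).symm

theorem shiftS_injective : Function.Injective shiftS := by
  intro φ χ h
  funext j
  simpa [shiftS] using congrFun h (j - 1)

theorem ker_aeval_shiftS {n : ℕ} {z : Fin n → ℂ} (hz0 : ∀ ℓ, z ℓ ≠ 0)
    (hzinj : Function.Injective z) (s0 : ℕ) (s : Fin n → ℕ) :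
    LinearMap.ker (Polynomial.aeval shiftS (Polynomial.X ^ s0
        * ∏ ℓ : Fin n, (Polynomial.X - Polynomial.C (z ℓ)) ^ s ℓ))
      = ⨆ ℓ, PhiSpan (z ℓ) (s ℓ) := by
  have hX : LinearMap.ker (shiftS ^ s0) = ⊥ := by
    rw [LinearMap.ker_eq_bot, Module.End.coe_pow]
    exact shiftS_injective.iterate s0
  rw [map_mul, map_pow, Polynomial.aeval_X, Module.End.mul_eq_comp,
    LinearMap.ker_comp_of_ker_eq_bot _ hX, ker_aeval_prod_of_pairwise_isCoprime]
  · simp only [Finset.mem_univ, iSup_pos, fun ℓ => ker_aeval_shiftS_X_sub_C_pow (hz0 ℓ)]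
  · exact fun i j hij => (Polynomial.pairwise_coprime_X_sub_C hzinj hij).pow

/-- The embedding `φ ↦ φ|m⟩` of scalar sequences into vector sequences. -/
def embedAt (d : ℕ) (m : Fin d) : (ℤ → ℂ) →ₗ[ℂ] SeqSp d where
  toFun φ := fun j => φ j • (Pi.single m 1 : Fin d → ℂ)
  map_add' _ _ := by funext j; simp [add_smul]
  map_smul' _ _ := by funext j; simp [mul_smul]

theorem embedAt_apply (d : ℕ) (m : Fin d) (φ : ℤ → ℂ) (j : ℤ) (k : Fin d) :
    embedAt d m φ j k = if k = m then φ j else 0 := by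
  simp [embedAt, Pi.single_apply]

theorem sum_embedAt (d : ℕ) (Ψ : SeqSp d) : ∑ m, embedAt d m (fun i => Ψ i m) = Ψ := by
  funext j k
  simp [Finset.sum_apply, embedAt_apply]

theorem map_embedAt_le_WD {d d₀ n : ℕ} (z : Fin n → ℂ) (smult : Fin d → Fin n → ℕ)
    {m : Fin d} (hm : (m : ℕ) < d₀) :
    (⨆ ℓ, PhiSpan (z ℓ) (smult m ℓ)).map (embedAt d m) ≤ WD d d₀ n z smult := by
  rw [Submodule.map_iSup]
  refine iSup_le fun ℓ => ?_
  rw [PhiSpan, Submodule.map_span, Submodule.span_le]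
  rintro _ ⟨_, ⟨v, hv, rfl⟩, rfl⟩
  exact Submodule.subset_span ⟨m, hm, ℓ, v, hv, rfl⟩

theorem mem_ker_diagPolyOp {d : ℕ} {g : Fin d → Polynomial ℂ} {Ψ : SeqSp d} :
    Ψ ∈ LinearMap.ker (diagPolyOp d g)
      ↔ ∀ m, (fun i => Ψ i m) ∈ LinearMap.ker (Polynomial.aeval shiftS (g m)) := by
  simp only [LinearMap.mem_ker]
  exact ⟨fun h m => funext fun j => congrFun (congrFun h j) m,
    fun h => funext fun j => funext fun m => congrFun (h m) j⟩

theorem WD_apply_eq_zero {d d₀ n : ℕ} {z : Fin n → ℂ} {smult : Fin d → Fin n → ℕ}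
    {Ψ : SeqSp d} (hΨ : Ψ ∈ WD d d₀ n z smult) (j : ℤ) {k : Fin d} (hk : d₀ ≤ k) :
    Ψ j k = 0 := by
  induction hΨ using Submodule.span_induction with
  | mem Ψ h =>
    obtain ⟨m, hm, ℓ, v, -, rfl⟩ := h
    have hkm : k ≠ m := by rintro rfl; lia
    simp [PhiVec, hkm]
  | zero => rfl
  | add Ψ Φ _ _ hΨ hΦ => simp [hΨ, hΦ]
  | smul c Ψ _ hΨ => simp [hΨ]

theorem stmt_8 (d : ℕ) (hd : 1 ≤ d) (d₀ : ℕ) (hd₀ : d₀ ≤ d)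
    (g : Fin d → Polynomial ℂ)
    (n : ℕ) (z : Fin n → ℂ) (hz0 : ∀ ℓ, z ℓ ≠ 0) (hzinj : Function.Injective z)
    (s0 : Fin d → ℕ) (smult : Fin d → Fin n → ℕ)
    (hmonic : ∀ m : Fin d, (m : ℕ) < d₀ → (g m).Monic)
    (hfact : ∀ m : Fin d, (m : ℕ) < d₀ →
      g m = Polynomial.X ^ (s0 m)
        * ∏ ℓ : Fin n, (Polynomial.X - Polynomial.C (z ℓ)) ^ (smult m ℓ)) :
    LinearMap.ker (diagPolyOp d (fun m => if (m : ℕ) < d₀ then g m else 0))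
        = WD d d₀ n z smult ⊔ piRange d d₀ ∧
      Disjoint (WD d d₀ n z smult) (piRange d d₀) := by
  have hker (m : Fin d) (hm : (m : ℕ) < d₀) :
      LinearMap.ker (Polynomial.aeval shiftS (if (m : ℕ) < d₀ then g m else 0))
        = ⨆ ℓ, PhiSpan (z ℓ) (smult m ℓ) := by
    rw [if_pos hm, hfact m hm, ker_aeval_shiftS hz0 hzinj]
  refine ⟨le_antisymm (fun Ψ hΨ => ?_) (sup_le ?_ fun Ψ hΨ => ?_), ?_⟩
  · rw [mem_ker_diagPolyOp] at hΨ
    rw [← sum_embedAt d Ψ]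
    refine sum_mem fun m _ => ?_
    by_cases hm : (m : ℕ) < d₀
    · refine Submodule.mem_sup_left (map_embedAt_le_WD z smult hm ?_)
      exact Submodule.mem_map_of_mem (hker m hm ▸ hΨ m)
    · refine Submodule.mem_sup_right fun j k hk => ?_
      have hkm : k ≠ m := by rintro rfl; exact hm hk
      simp [embedAt_apply, hkm]
  · rw [WD, Submodule.span_le]
    rintro _ ⟨m, hm, ℓ, v, hv, rfl⟩
    rw [SetLike.mem_coe, mem_ker_diagPolyOp]
    intro k
    have hcomp : (fun i => PhiVec d (z ℓ) v m i k) = if k = m then Phi (z ℓ) v else 0 := by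
      funext i
      change embedAt d m (Phi (z ℓ) v) i k = _
      rw [embedAt_apply]
      split_ifs <;> rfl
    rw [hcomp]
    by_cases hkm : k = m
    · subst hkm
      rw [hker k hm, if_pos rfl]
      exact Submodule.mem_iSup_of_mem ℓ (Phi_mem_PhiSpan _ (Finset.mem_Icc.mp hv).2)
    · rw [if_neg hkm]
      exact zero_mem _
  · rw [mem_ker_diagPolyOp]
    intro m
    by_cases hm : (m : ℕ) < d₀
    · have : (fun i => Ψ i m) = 0 := funext fun i => hΨ i m hm
      rw [this]
      exact zero_mem _
    · simp [hm]
  · rw [Submodule.disjoint_def]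
    intro Ψ hW hP
    funext j m
    rcases lt_or_ge (m : ℕ) d₀ with hm | hm
    · exact hP j m hm
    · exact WD_apply_eq_zero hW j hm

end
end

section
/- Let 𝐀 be a regular BBL transformation of bandwidth (p,q) on V_d^S with symbol A(w,w⁻¹), and let z_1, …, z_n be the distinct nonzero roots of the polynomial w^{−dp} det A(w,w⁻¹), with multiplicities s_1, …, s_n. Then Ker 𝐀 = ⨁_{ℓ=1}^{n} (Ker 𝐀 ∩ T_{z_ℓ, s_ℓ}), and dim(Ker 𝐀 ∩ T_{z_ℓ, s_ℓ}) = s_ℓ for each ℓ; in particular dim Ker 𝐀 = s_1 + ⋯ + s_n. -/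
noncomputable section

open Polynomial Module

/-! ### Scalar shift polynomials -/

lemma shiftBy_mul (d : ℕ) (m n : ℤ) : shiftBy d m * shiftBy d n = shiftBy d (m + n) := by
  ext Ψ j i
  simp [shiftBy, add_assoc]

lemma shiftBy_zero (d : ℕ) : shiftBy d 0 = 1 := by
  ext Ψ j i
  simp [shiftBy]

lemma shiftBy_pow (d k : ℕ) : shiftBy d 1 ^ k = shiftBy d k := by
  induction k with
  | zero => simp [shiftBy_zero]
  | succ k ih => rw [pow_succ, ih, shiftBy_mul]; simp

lemma shiftBy_injective (d : ℕ) (n : ℤ) : Function.Injective (shiftBy d n) := by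
  refine Function.LeftInverse.injective (g := shiftBy d (-n)) fun Ψ => ?_
  rw [← End.mul_apply, shiftBy_mul, neg_add_cancel, shiftBy_zero, End.one_apply]

lemma aeval_X_sub_C_shiftBy (d : ℕ) (z : ℂ) :
    aeval (shiftBy d 1) (X - C z) = shiftBy d 1 - z • 1 := by
  simp [Algebra.algebraMap_eq_smul_one]

lemma ff_succ (j : ℤ) (v : ℕ) : ff j (v + 1) = ff j v * (j - v) :=
  Finset.prod_range_succ _ _

lemma ff_add_one_succ (j : ℤ) (v : ℕ) : ff (j + 1) (v + 1) = (j + 1) * ff j v := by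
  unfold ff
  rw [Finset.prod_range_succ', mul_comm]
  simp

lemma PhiVec_one_apply (d : ℕ) (z : ℂ) (m : Fin d) (j : ℤ) :
    PhiVec d z 1 m j = z ^ j • (Pi.single m 1 : Fin d → ℂ) := by
  simp [PhiVec, Phi, ff]

lemma shiftBy_sub_smul_PhiVec (d : ℕ) {z : ℂ} (hz : z ≠ 0) (v : ℕ) (m : Fin d) :
    (shiftBy d 1 - z • 1) (PhiVec d z (v + 1) m) = (v : ℂ) • PhiVec d z v m := by
  have key : ∀ j, Phi z (v + 1) (j + 1) - z * Phi z (v + 1) j = v * Phi z v j := by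
    intro j
    rcases v with _ | v
    · simp [Phi, ff, zpow_add_one₀ hz, mul_comm]
    · have h1 : z ^ (j - ((v : ℤ) + 1 + 1) + 1) * z = z ^ (j - ((v : ℤ) + 1) + 1) := by
        rw [← zpow_add_one₀ hz]; congr 1; ring
      have h2 : j + 1 - ((v : ℤ) + 1 + 1) + 1 = j - ((v : ℤ) + 1) + 1 := by ring
      simp only [Phi, Nat.add_eq_zero_iff, one_ne_zero, and_false, if_false,
        Nat.add_sub_cancel, ff_add_one_succ, Nat.cast_add, Nat.cast_one, h2]
      rw [← h1, ff_succ]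
      push_cast
      ring
  funext j i
  have := key j
  simp only [shiftBy, PhiVec, LinearMap.sub_apply, LinearMap.smul_apply, End.one_apply,
    Pi.sub_apply, Pi.smul_apply, LinearMap.coe_mk, AddHom.coe_mk, smul_eq_mul]
  rw [← mul_assoc, ← mul_assoc, ← sub_mul, this]

lemma mem_ker_shiftBy_sub_smul {d : ℕ} {z : ℂ} (hz : z ≠ 0) {Ψ : SeqSp d} :
    Ψ ∈ LinearMap.ker (shiftBy d 1 - z • 1) ↔ ∀ j, Ψ j = z ^ j • Ψ 0 := by
  have hstep : Ψ ∈ LinearMap.ker (shiftBy d 1 - z • 1) ↔ ∀ j, Ψ (j + 1) = z • Ψ j := by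
    rw [LinearMap.mem_ker, LinearMap.sub_apply, sub_eq_zero, funext_iff]
    rfl
  rw [hstep]
  constructor
  · intro h j
    induction j using Int.induction_on with
    | zero => simp
    | succ i ih => rw [h, ih, smul_smul, zpow_add_one₀ hz, mul_comm]
    | pred i ih =>
      have h' := h (-(i : ℤ) - 1)
      rw [sub_add_cancel, ih] at h'
      rw [zpow_sub_one₀ hz, mul_comm, mul_smul, h', smul_smul, inv_mul_cancel₀ hz, one_smul]
  · intro h j
    rw [h, h j, smul_smul, zpow_add_one₀ hz, mul_comm]

lemma PhiVec_mem_Tspace {d : ℕ} {z : ℂ} {s v : ℕ} (hv : v < s) (m : Fin d) :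
    PhiVec d z (v + 1) m ∈ Tspace d z s :=
  Submodule.subset_span ⟨v + 1, by simp; omega, m, rfl⟩

lemma ker_shiftBy_sub_smul_le_Tspace {d : ℕ} {z : ℂ} (hz : z ≠ 0) (s : ℕ) :
    LinearMap.ker (shiftBy d 1 - z • 1) ≤ Tspace d z (s + 1) := by
  intro Ψ hΨ
  rw [mem_ker_shiftBy_sub_smul hz] at hΨ
  have : Ψ = ∑ m, Ψ 0 m • PhiVec d z 1 m := by
    funext j i
    simp [Finset.sum_apply, PhiVec_one_apply, hΨ j, Pi.single_apply, mul_comm]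
  rw [this]
  exact Submodule.sum_mem _ fun m _ => Submodule.smul_mem _ _ (PhiVec_mem_Tspace s.succ_pos m)

lemma map_shiftBy_sub_smul_Tspace {d : ℕ} {z : ℂ} (hz : z ≠ 0) (s : ℕ) :
    (Tspace d z (s + 1)).map (shiftBy d 1 - z • 1) = Tspace d z s := by
  apply le_antisymm
  · rw [Submodule.map_le_iff_le_comap]
    refine Submodule.span_le.2 ?_
    rintro _ ⟨v, hv, m, rfl⟩
    rw [Finset.mem_Icc] at hv
    obtain ⟨v, rfl⟩ := Nat.exists_eq_add_of_le' hv.1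
    rw [SetLike.mem_coe, Submodule.mem_comap, shiftBy_sub_smul_PhiVec d hz]
    rcases v with _ | v
    · simp
    · exact Submodule.smul_mem _ _ (PhiVec_mem_Tspace (by omega) m)
  · refine Submodule.span_le.2 ?_
    rintro _ ⟨v, hv, m, rfl⟩
    rw [Finset.mem_Icc] at hv
    refine ⟨(v : ℂ)⁻¹ • PhiVec d z (v + 1) m,
      Submodule.smul_mem _ _ (PhiVec_mem_Tspace (by omega) m), ?_⟩
    have hv0 : (v : ℂ) ≠ 0 := by exact_mod_cast (by omega : v ≠ 0)
    rw [map_smul, shiftBy_sub_smul_PhiVec d hz, smul_smul, inv_mul_cancel₀ hv0, one_smul]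

lemma Tspace_eq_ker_pow {d : ℕ} {z : ℂ} (hz : z ≠ 0) (s : ℕ) :
    Tspace d z s = LinearMap.ker ((shiftBy d 1 - z • 1) ^ s) := by
  induction s with
  | zero => simp [Tspace, End.one_eq_id, LinearMap.ker_id]
  | succ s ih =>
    have hk := ker_shiftBy_sub_smul_le_Tspace (d := d) hz s
    rw [pow_succ, End.mul_eq_comp, LinearMap.ker_comp, ← ih, ← map_shiftBy_sub_smul_Tspace hz s,
      Submodule.comap_map_eq, sup_eq_left.2 hk]

lemma Tspace_le_maxGenEigenspace {d : ℕ} {z : ℂ} (hz : z ≠ 0) (s : ℕ) :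
    Tspace d z s ≤ (shiftBy d 1).maxGenEigenspace z := by
  intro Ψ hΨ
  rw [Tspace_eq_ker_pow hz] at hΨ
  exact (End.mem_maxGenEigenspace _ _ _).2 ⟨s, hΨ⟩

lemma exists_mem_Tspace_of_mem_maxGenEigenspace {d : ℕ} {z : ℂ} (hz : z ≠ 0) {Ψ : SeqSp d}
    (hΨ : Ψ ∈ (shiftBy d 1).maxGenEigenspace z) : ∃ s, Ψ ∈ Tspace d z s := by
  obtain ⟨k, hk⟩ := (End.mem_maxGenEigenspace _ _ _).1 hΨ
  exact ⟨k, by rwa [Tspace_eq_ker_pow hz]⟩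

lemma exists_shiftBy_sub_smul_self_eq {d : ℕ} {z : ℂ} (hz : z ≠ 0) {Ψ : SeqSp d}
    (hΨ : Ψ ∈ (shiftBy d 1).maxGenEigenspace z) :
    ∃ Φ ∈ (shiftBy d 1).maxGenEigenspace z, (shiftBy d 1 - z • 1) Φ = Ψ := by
  obtain ⟨s, hs⟩ := exists_mem_Tspace_of_mem_maxGenEigenspace hz hΨ
  rw [← map_shiftBy_sub_smul_Tspace hz] at hs
  obtain ⟨Φ, hΦ, rfl⟩ := hs
  exact ⟨Φ, Tspace_le_maxGenEigenspace hz _ hΦ, rfl⟩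

/-! ### Generalized eigenspaces and polynomials -/

section Endomorphism

variable {K V : Type*} [Field K] [AddCommGroup V] [Module K V]

lemma aeval_mem_maxGenEigenspace (f : End K V) (g : K[X]) (z : K) {x : V}
    (hx : x ∈ f.maxGenEigenspace z) : aeval f g x ∈ f.maxGenEigenspace z :=
  End.mapsTo_maxGenEigenspace_of_comm
    (by simpa only [aeval_X] using (Commute.all (X : K[X]) g).map (aeval f)) z hx

lemma exists_aeval_left_inverse (f : End K V) {g : K[X]} {z : K} (hg : g.eval z ≠ 0) {x : V}
    (hx : x ∈ f.maxGenEigenspace z) : ∃ h : K[X], aeval f (h * g) x = x := by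
  obtain ⟨k, hk⟩ := (End.mem_maxGenEigenspace _ _ _).1 hx
  have hcop : IsCoprime g ((X - C z) ^ k) := by
    refine IsCoprime.pow_right (IsCoprime.symm ?_)
    refine (irreducible_X_sub_C z).coprime_iff_not_dvd.2 ?_
    rwa [dvd_iff_isRoot]
  obtain ⟨a, b, hab⟩ := hcop
  refine ⟨a, ?_⟩
  have h0 : aeval f (b * (X - C z) ^ k) x = 0 := by
    have : aeval f (X - C z) = f - z • 1 := by simp [Algebra.algebraMap_eq_smul_one]
    rw [map_mul, map_pow, this, End.mul_apply, hk, map_zero]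
  calc aeval f (a * g) x = aeval f (a * g + b * (X - C z) ^ k) x := by
        rw [map_add, LinearMap.add_apply, h0, add_zero]
    _ = x := by rw [hab, map_one, End.one_apply]

lemma eq_zero_of_aeval_eq_zero (f : End K V) {g : K[X]} {z : K} (hg : g.eval z ≠ 0) {x : V}
    (hx : x ∈ f.maxGenEigenspace z) (h0 : aeval f g x = 0) : x = 0 := by
  obtain ⟨h, hh⟩ := exists_aeval_left_inverse f hg hx
  rw [← hh, map_mul, End.mul_apply, h0, map_zero]

lemma exists_aeval_eq (f : End K V) {g : K[X]} {z : K} (hg : g.eval z ≠ 0) {x : V}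
    (hx : x ∈ f.maxGenEigenspace z) : ∃ y ∈ f.maxGenEigenspace z, aeval f g y = x := by
  obtain ⟨h, hh⟩ := exists_aeval_left_inverse f hg hx
  refine ⟨aeval f h x, aeval_mem_maxGenEigenspace f h z hx, ?_⟩
  rw [← End.mul_apply, ← map_mul, mul_comm, hh]

lemma inf_ker_aeval_prod_le {ι : Type*} (f : End K V) (N S : Submodule K V)
    (hN : ∀ g : K[X], ∀ x ∈ N, aeval f g x ∈ N) (t : Finset ι) (g : ι → K[X])
    (hcop : (t : Set ι).Pairwise (Function.onFun IsCoprime g))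
    (hS : ∀ i ∈ t, N ⊓ LinearMap.ker (aeval f (g i)) ≤ S) :
    N ⊓ LinearMap.ker (aeval f (∏ i ∈ t, g i)) ≤ S := by
  classical
  induction t using Finset.induction_on with
  | empty =>
    rintro x ⟨-, hx⟩
    rw [Finset.prod_empty, map_one] at hx
    rw [show x = 0 from hx]
    exact S.zero_mem
  | insert i t hi ih =>
    rintro x ⟨hxN, hx⟩
    rw [Finset.prod_insert hi] at hx
    have hc : IsCoprime (g i) (∏ j ∈ t, g j) := IsCoprime.prod_right fun j hj =>
      hcop (by simp) (by simp [hj]) (by rintro rfl; exact hi hj)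
    obtain ⟨a, b, hab⟩ := hc
    have hsplit : x = aeval f (a * g i) x + aeval f (b * ∏ j ∈ t, g j) x := by
      rw [← LinearMap.add_apply, ← map_add, hab, map_one, End.one_apply]
    rw [SetLike.mem_coe, LinearMap.mem_ker] at hx
    rw [hsplit]
    refine S.add_mem (ih (hcop.mono (by simp)) (fun j hj => hS j (by simp [hj]))
      ⟨hN _ _ hxN, ?_⟩) (hS i (by simp) ⟨hN _ _ hxN, ?_⟩)
    · rw [SetLike.mem_coe, LinearMap.mem_ker, ← End.mul_apply, ← map_mul,
        show (∏ j ∈ t, g j) * (a * g i) = a * (g i * ∏ j ∈ t, g j) by ring, map_mul,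
        End.mul_apply, hx, map_zero]
    · rw [SetLike.mem_coe, LinearMap.mem_ker, ← End.mul_apply, ← map_mul,
        show g i * (b * ∏ j ∈ t, g j) = b * (g i * ∏ j ∈ t, g j) by ring, map_mul,
        End.mul_apply, hx, map_zero]

lemma rank_ker_mul_inf (f g : End K V) (W : Submodule K V) (hg : ∀ x ∈ W, g x ∈ W)
    (hsurj : ∀ y ∈ W, ∃ x ∈ W, g x = y) :
    Module.rank K ↥(LinearMap.ker (f * g) ⊓ W) =
      Module.rank K ↥(LinearMap.ker f ⊓ W) + Module.rank K ↥(LinearMap.ker g ⊓ W) := by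
  have hmaps : ∀ x ∈ LinearMap.ker (f * g) ⊓ W, g x ∈ LinearMap.ker f ⊓ W :=
    fun x hx => ⟨hx.1, hg x hx.2⟩
  let h := g.restrict hmaps
  have hs : Function.Surjective h := by
    rintro ⟨y, hy1, hy2⟩
    obtain ⟨x, hx, rfl⟩ := hsurj y hy2
    exact ⟨⟨x, hy1, hx⟩, rfl⟩
  have hker : (LinearMap.ker h).map (Submodule.subtype _) = LinearMap.ker g ⊓ W := by
    ext x
    constructor
    · rintro ⟨y, hy, rfl⟩
      exact ⟨congrArg Subtype.val hy, y.2.2⟩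
    · rintro ⟨hx1, hx2⟩
      have hx1' : g x = 0 := hx1
      exact ⟨⟨x, by simp [hx1'], hx2⟩, Subtype.ext hx1', rfl⟩
  rw [LinearMap.rank_eq_of_surjective hs, ← hker]
  congr 1
  exact (Submodule.equivMapOfInjective _ (Submodule.injective_subtype _) _).rank_eq

lemma finrank_iSup_eq_sum {ι : Type*} [Fintype ι] (p : ι → Submodule K V)
    [∀ i, Module.Finite K (p i)] (hp : iSupIndep p) :
    finrank K ↥(⨆ i, p i) = ∑ i, finrank K (p i) := by
  classical
  rw [Submodule.iSup_eq_range_dfinsupp_lsum,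
    ← (LinearEquiv.ofInjective _ hp.dfinsupp_lsum_injective).finrank_eq]
  exact finrank_directSum K fun i => p i

end Endomorphism

lemma mem_ker_mul_add_one_sub_iff {K V : Type*} [Field K] [AddCommGroup V] [Module K V]
    {t e : End K V} (he : IsIdempotentElem e) (hte : Commute t e) {x : V} :
    x ∈ LinearMap.ker (t * e + (1 - e)) ↔ e x = x ∧ t x = 0 := by
  rw [LinearMap.mem_ker]
  constructor
  · intro h
    have h1 : e * (t * e + (1 - e)) = t * e := by
      rw [mul_add, mul_sub, mul_one, he.eq, sub_self, add_zero, ← mul_assoc, ← hte.eq, mul_assoc,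
        he.eq]
    have h2 : (t * e) x = 0 := by rw [← h1, End.mul_apply, h, map_zero]
    have h3 : e x = x := by
      rw [LinearMap.add_apply, h2, zero_add, LinearMap.sub_apply, sub_eq_zero] at h
      exact h.symm
    exact ⟨h3, by rwa [End.mul_apply, h3] at h2⟩
  · rintro ⟨h1, h2⟩
    simp [h1, h2]

lemma exists_mul_add_one_sub_eq {K V : Type*} [Field K] [AddCommGroup V] [Module K V]
    {t e : End K V} (he : IsIdempotentElem e) (hte : Commute t e) {W : Submodule K V}
    (hW : ∀ x ∈ W, e x ∈ W) (ht : ∀ y ∈ W, ∃ x ∈ W, t x = y) {y : V} (hy : y ∈ W) :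
    ∃ x ∈ W, (t * e + (1 - e)) x = y := by
  obtain ⟨x, hx, rfl⟩ := ht y hy
  have hee : ∀ v, e (e v) = e v := fun v => congrArg (fun f : End K V => f v) he.eq
  have hc : ∀ v, e (t v) = t (e v) := fun v => congrArg (fun f : End K V => f v) hte.eq.symm
  refine ⟨e x + (t x - e (t x)), W.add_mem (hW _ hx) (W.sub_mem hy (hW _ hy)), ?_⟩
  simp [hee, hc]

/-! ### The action of matrix polynomials on sequences -/

/-- `matOp` as a ring homomorphism. -/
def matOpHom (d : ℕ) : Matrix (Fin d) (Fin d) ℂ →+* End ℂ (SeqSp d) where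
  toFun := matOp d
  map_one' := by ext; simp [matOp]
  map_mul' M N := by ext; simp [matOp]
  map_zero' := by ext; simp [matOp]
  map_add' M N := by ext; simp [matOp, Matrix.add_mulVec]

lemma commute_matOpHom_shiftBy (d : ℕ) (M : Matrix (Fin d) (Fin d) ℂ) (n : ℤ) :
    Commute (matOpHom d M) (shiftBy d n) := by
  ext; rfl

/-- A matrix polynomial acts on sequences by letting the variable act as the left shift. -/
def matPolyAct (d : ℕ) : Matrix (Fin d) (Fin d) ℂ[X] →+* End ℂ (SeqSp d) :=
  (eval₂RingHom' (matOpHom d) (shiftBy d 1) fun M => commute_matOpHom_shiftBy d M 1).comp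
    (matPolyEquiv : Matrix (Fin d) (Fin d) ℂ[X] ≃ₐ[ℂ] _).toRingEquiv.toRingHom

lemma matPolyAct_map_C (d : ℕ) (M : Matrix (Fin d) (Fin d) ℂ) :
    matPolyAct d (M.map C) = matOp d M := by
  simp [matPolyAct, matOpHom]

lemma matPolyAct_smul_one (d : ℕ) (g : ℂ[X]) :
    matPolyAct d (g • 1) = aeval (shiftBy d 1) g := by
  have h : (matOpHom d).comp (algebraMap ℂ (Matrix (Fin d) (Fin d) ℂ)) =
      algebraMap ℂ (End ℂ (SeqSp d)) := by
    ext c Ψ j i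
    simp [matOpHom, matOp, Algebra.algebraMap_eq_smul_one, Matrix.smul_mulVec]
  simp [matPolyAct, eval₂_map, h, aeval_def]

lemma matPolyAct_smul (d : ℕ) (g : ℂ[X]) (A : Matrix (Fin d) (Fin d) ℂ[X]) :
    matPolyAct d (g • A) = aeval (shiftBy d 1) g * matPolyAct d A := by
  rw [← matPolyAct_smul_one, ← map_mul, smul_mul_assoc, one_mul]

lemma commute_aeval_matPolyAct (d : ℕ) (g : ℂ[X]) (A : Matrix (Fin d) (Fin d) ℂ[X]) :
    Commute (aeval (shiftBy d 1) g) (matPolyAct d A) := by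
  rw [← matPolyAct_smul_one]
  exact Commute.map (by simp [Commute, SemiconjBy]) _

lemma matPolyAct_mem_maxGenEigenspace {d : ℕ} (A : Matrix (Fin d) (Fin d) ℂ[X]) (z : ℂ)
    {Ψ : SeqSp d} (hΨ : Ψ ∈ (shiftBy d 1).maxGenEigenspace z) :
    matPolyAct d A Ψ ∈ (shiftBy d 1).maxGenEigenspace z :=
  End.mapsTo_maxGenEigenspace_of_comm
    (by simpa only [aeval_X] using commute_aeval_matPolyAct d X A) z hΨ

lemma ker_matPolyAct_le_ker_aeval_det (d : ℕ) (A : Matrix (Fin d) (Fin d) ℂ[X]) :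
    LinearMap.ker (matPolyAct d A) ≤ LinearMap.ker (aeval (shiftBy d 1) A.det) := by
  rw [← matPolyAct_smul_one, ← Matrix.adjugate_mul, map_mul]
  exact LinearMap.ker_le_ker_comp _ _

/-- The matrix polynomial acting as `X - w` on the range of `E` and trivially on its kernel. -/
def elemFactor {d : ℕ} (E : Matrix (Fin d) (Fin d) ℂ) (w : ℂ) : Matrix (Fin d) (Fin d) ℂ[X] :=
  (X - C w) • E.map C + (1 - E.map C)

lemma det_elemFactor {d : ℕ} {u v : Fin d → ℂ} (huv : u ⬝ᵥ v = 1) (w : ℂ) :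
    (elemFactor (Matrix.vecMulVec v u) w).det = X - C w := by
  have h : elemFactor (Matrix.vecMulVec v u) w =
      1 + Matrix.replicateCol Unit (fun i => (X - C w - 1) * C (v i)) *
        Matrix.replicateRow Unit fun i => C (u i) := by
    ext1 i j
    simp [elemFactor, Matrix.vecMulVec, Matrix.mul_apply]
    ring
  have h2 : (fun i => C (u i)) ⬝ᵥ (fun i => (X - C w - 1) * C (v i)) =
      (X - C w - 1) * C (u ⬝ᵥ v) := by
    simp only [dotProduct, map_sum, Finset.mul_sum, map_mul]
    exact Finset.sum_congr rfl fun i _ => by ring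
  rw [h, Matrix.det_one_add_replicateCol_mul_replicateRow, h2, huv]
  simp

lemma exists_eq_mul_elemFactor {d : ℕ} {A : Matrix (Fin d) (Fin d) ℂ[X]} {w : ℂ}
    (hw : A.det.IsRoot w) :
    ∃ (B : Matrix (Fin d) (Fin d) ℂ[X]) (u v : Fin d → ℂ), u ⬝ᵥ v = 1 ∧
      A = B * elemFactor (Matrix.vecMulVec v u) w := by
  have hdet : (A.map (eval w)).det = 0 := by
    rw [← matPolyEquiv_eval_eq_map, ← eval_det]
    exact hw
  obtain ⟨v, hv0, hv⟩ := Matrix.exists_mulVec_eq_zero_iff.2 hdet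
  obtain ⟨i, hi⟩ := Function.ne_iff.1 hv0
  have huv : (Pi.single i (v i)⁻¹ : Fin d → ℂ) ⬝ᵥ v = 1 := by
    simpa using inv_mul_cancel₀ hi
  generalize (Pi.single i (v i)⁻¹ : Fin d → ℂ) = u at huv
  set E := Matrix.vecMulVec v u with hE
  have hEE : E * E = E := by
    rw [hE, Matrix.vecMulVec_mul_vecMulVec, huv, one_smul]
  have hEE' : E.map C * E.map C = E.map (C : ℂ →+* ℂ[X]) := by
    rw [← Matrix.map_mul, hEE]
  have hdvd : ∀ k l, X - C w ∣ (A * E.map C) k l := by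
    intro k l
    have hk : ∑ j, eval w (A k j) * v j = 0 := congrFun hv k
    rw [dvd_iff_isRoot, IsRoot, Matrix.mul_apply, eval_finsetSum]
    simp only [hE, eval_mul, Matrix.map_apply, Matrix.vecMulVec_apply, eval_C, ← mul_assoc]
    rw [← Finset.sum_mul, hk, zero_mul]
  choose G hG using hdvd
  have hG' : A * E.map C = (X - C w) • Matrix.of G := by
    ext1 k l
    simp [hG]
  have hGE : Matrix.of G * E.map C = Matrix.of G := by
    have : (X - C w) • (Matrix.of G * E.map C) = (X - C w) • Matrix.of G := by
      rw [← smul_mul_assoc, ← hG', mul_assoc, hEE']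
    exact smul_right_injective _ (X_sub_C_ne_zero w) this
  refine ⟨Matrix.of G + A * (1 - E.map C), u, v, huv, ?_⟩
  have h1 : E.map C * (1 - E.map C) = (0 : Matrix (Fin d) (Fin d) ℂ[X]) := by
    rw [mul_sub, mul_one, hEE', sub_self]
  have h2 : (1 - E.map C) * E.map C = (0 : Matrix (Fin d) (Fin d) ℂ[X]) := by
    rw [sub_mul, one_mul, hEE', sub_self]
  have h3 : (1 - E.map C) * (1 - E.map C) = (1 - E.map C : Matrix (Fin d) (Fin d) ℂ[X]) := by
    rw [mul_sub, h2, mul_one, sub_zero]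
  rw [elemFactor, add_mul, mul_add, mul_add, mul_smul_comm, mul_smul_comm, hGE, ← hG',
    mul_assoc A, mul_assoc A, h2, h3, mul_sub (Matrix.of G), hGE, mul_zero, smul_zero, mul_one,
    sub_self, mul_sub, mul_one]
  abel

lemma matPolyAct_elemFactor {d : ℕ} (E : Matrix (Fin d) (Fin d) ℂ) (w : ℂ) :
    matPolyAct d (elemFactor E w) =
      aeval (shiftBy d 1) (X - C w) * matOp d E + (1 - matOp d E) := by
  rw [elemFactor, map_add, matPolyAct_smul, map_sub (matPolyAct d), map_one, matPolyAct_map_C]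

lemma commute_aeval_matOp (d : ℕ) (g : ℂ[X]) (E : Matrix (Fin d) (Fin d) ℂ) :
    Commute (aeval (shiftBy d 1) g) (matOp d E) := by
  rw [← matPolyAct_map_C]
  exact commute_aeval_matPolyAct d g _

lemma isIdempotentElem_matOp_vecMulVec {d : ℕ} {u v : Fin d → ℂ} (huv : u ⬝ᵥ v = 1) :
    IsIdempotentElem (matOp d (Matrix.vecMulVec v u)) := by
  change matOpHom d _ * matOpHom d _ = matOpHom d _
  rw [← map_mul, Matrix.vecMulVec_mul_vecMulVec, huv, one_smul]

lemma rank_ker_elemFactor_inf {d : ℕ} {u v : Fin d → ℂ} (huv : u ⬝ᵥ v = 1) {z : ℂ} (hz : z ≠ 0)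
    (w : ℂ) :
    Module.rank ℂ ↥(LinearMap.ker (matPolyAct d (elemFactor (Matrix.vecMulVec v u) w)) ⊓
      (shiftBy d 1).maxGenEigenspace z) = ((X - C w).rootMultiplicity z : ℕ) := by
  have hmem : ∀ Ψ, Ψ ∈ LinearMap.ker (matPolyAct d (elemFactor (Matrix.vecMulVec v u) w)) ↔
      matOp d (Matrix.vecMulVec v u) Ψ = Ψ ∧ aeval (shiftBy d 1) (X - C w) Ψ = 0 := by
    intro Ψ
    rw [matPolyAct_elemFactor]
    exact mem_ker_mul_add_one_sub_iff (isIdempotentElem_matOp_vecMulVec huv)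
      (commute_aeval_matOp d _ _)
  rw [rootMultiplicity_X_sub_C]
  split_ifs with hzw
  · subst hzw
    have hv0 : v ≠ 0 := by rintro rfl; simp at huv
    let Φ : SeqSp d := fun j => z ^ j • v
    have hΦ0 : Φ ≠ 0 := fun h => hv0 (by simpa [Φ] using congrFun h 0)
    have hΦker : Φ ∈ LinearMap.ker (shiftBy d 1 - z • 1) :=
      (mem_ker_shiftBy_sub_smul hz).2 fun j => by simp [Φ]
    have hspan : LinearMap.ker (matPolyAct d (elemFactor (Matrix.vecMulVec v u) z)) ⊓
        (shiftBy d 1).maxGenEigenspace z = Submodule.span ℂ {Φ} := by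
      apply le_antisymm
      · rintro Ψ ⟨hΨ, -⟩
        obtain ⟨h1, h2⟩ := (hmem Ψ).1 hΨ
        rw [aeval_X_sub_C_shiftBy] at h2
        have h3 := (mem_ker_shiftBy_sub_smul hz).1 h2
        have h4 : (Matrix.vecMulVec v u).mulVec (Ψ 0) = Ψ 0 := congrFun h1 0
        refine Submodule.mem_span_singleton.2 ⟨u ⬝ᵥ Ψ 0, ?_⟩
        funext j
        rw [h3 j]
        nth_rw 2 [← h4]
        rw [Matrix.vecMulVec_mulVec]
        simp [Φ, smul_comm (z ^ j)]
      · rw [Submodule.span_singleton_le_iff_mem]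
        refine ⟨(hmem Φ).2 ⟨?_, ?_⟩, ?_⟩
        · funext j
          change (Matrix.vecMulVec v u).mulVec (z ^ j • v) = z ^ j • v
          rw [Matrix.mulVec_smul, Matrix.vecMulVec_mulVec, huv]
          simp
        · rw [aeval_X_sub_C_shiftBy]
          exact hΦker
        · exact Tspace_le_maxGenEigenspace hz _ (ker_shiftBy_sub_smul_le_Tspace hz 0 hΦker)
    rw [hspan, ← finrank_eq_rank, finrank_span_singleton hΦ0]
  · have hbot : LinearMap.ker (matPolyAct d (elemFactor (Matrix.vecMulVec v u) w)) ⊓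
        (shiftBy d 1).maxGenEigenspace z = ⊥ := by
      rw [eq_bot_iff]
      rintro Ψ ⟨hΨ, hΨz⟩
      exact eq_zero_of_aeval_eq_zero _ (by simpa [sub_eq_zero] using hzw) hΨz ((hmem Ψ).1 hΨ).2
    rw [hbot]
    simp

lemma exists_aeval_X_sub_C_eq {d : ℕ} {z : ℂ} (hz : z ≠ 0) (w : ℂ) {Ψ : SeqSp d}
    (hΨ : Ψ ∈ (shiftBy d 1).maxGenEigenspace z) :
    ∃ Φ ∈ (shiftBy d 1).maxGenEigenspace z, aeval (shiftBy d 1) (X - C w) Φ = Ψ := by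
  by_cases hzw : z = w
  · subst hzw
    rw [aeval_X_sub_C_shiftBy]
    exact exists_shiftBy_sub_smul_self_eq hz hΨ
  · exact exists_aeval_eq _ (by simpa [sub_eq_zero] using hzw) hΨ

/-- On the generalized `z`-eigenspace of the shift, the kernel of a matrix polynomial has dimension
the multiplicity of `z` as a root of the determinant. -/
theorem rank_ker_matPolyAct_inf {d : ℕ} {z : ℂ} (hz : z ≠ 0) (A : Matrix (Fin d) (Fin d) ℂ[X])
    (hA : A.det ≠ 0) :
    Module.rank ℂ ↥(LinearMap.ker (matPolyAct d A) ⊓ (shiftBy d 1).maxGenEigenspace z) =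
      (A.det.rootMultiplicity z : ℕ) := by
  induction hn : A.det.natDegree generalizing A with
  | zero =>
    rw [natDegree_eq_zero] at hn
    obtain ⟨c, hc⟩ := hn
    have hc0 : c ≠ 0 := by rintro rfl; simp [← hc] at hA
    have hbot : LinearMap.ker (matPolyAct d A) ⊓ (shiftBy d 1).maxGenEigenspace z = ⊥ := by
      rw [eq_bot_iff]
      rintro Ψ ⟨hΨ, hΨz⟩
      have := ker_matPolyAct_le_ker_aeval_det d A hΨ
      exact eq_zero_of_aeval_eq_zero _ (by simpa [← hc] using hc0) hΨz this
    rw [hbot, ← hc]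
    simp
  | succ n ih =>
    obtain ⟨w, hw⟩ := IsAlgClosed.exists_root A.det
      (by rw [degree_eq_natDegree hA, hn]; exact_mod_cast n.succ_ne_zero)
    obtain ⟨B, u, v, huv, rfl⟩ := exists_eq_mul_elemFactor hw
    rw [Matrix.det_mul, det_elemFactor huv] at hA hn ⊢
    have hB : B.det ≠ 0 := left_ne_zero_of_mul hA
    rw [natDegree_mul hB (X_sub_C_ne_zero w), natDegree_X_sub_C] at hn
    rw [rootMultiplicity_mul hA, map_mul, rank_ker_mul_inf, ih B hB (by omega),
      rank_ker_elemFactor_inf huv hz, Nat.cast_add]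
    · exact fun Ψ hΨ => matPolyAct_mem_maxGenEigenspace _ z hΨ
    · intro Ψ hΨ
      rw [matPolyAct_elemFactor]
      refine exists_mul_add_one_sub_eq (isIdempotentElem_matOp_vecMulVec huv)
        (commute_aeval_matOp d _ _) (fun Φ hΦ => ?_)
        (fun Φ hΦ => exists_aeval_X_sub_C_eq hz w hΦ) hΨ
      rw [← matPolyAct_map_C]
      exact matPolyAct_mem_maxGenEigenspace _ z hΦ

/-! ### Banded block-Laurent transformations -/

/-- The matrix polynomial `w ^ (-p) A(w, w⁻¹)`. -/
def bblPoly (d : ℕ) (a : ℤ → Matrix (Fin d) (Fin d) ℂ) (p q : ℤ) :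
    Matrix (Fin d) (Fin d) ℂ[X] :=
  ∑ r ∈ Finset.Icc p q, (X : ℂ[X]) ^ (r - p).toNat • (a r).map C

lemma bbl_eq (d : ℕ) (a : ℤ → Matrix (Fin d) (Fin d) ℂ) (p q : ℤ) :
    bbl d a p q = shiftBy d p * matPolyAct d (bblPoly d a p q) := by
  rw [bbl, bblPoly, map_sum, Finset.mul_sum]
  refine Finset.sum_congr rfl fun r hr => ?_
  have hr' : p + ((r - p).toNat : ℤ) = r := by
    rw [Finset.mem_Icc] at hr; omega
  rw [matPolyAct_smul, matPolyAct_map_C, map_pow, aeval_X, shiftBy_pow, ← mul_assoc, shiftBy_mul,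
    hr']
  exact (commute_matOpHom_shiftBy d (a r) r).eq

lemma ker_bbl (d : ℕ) (a : ℤ → Matrix (Fin d) (Fin d) ℂ) (p q : ℤ) :
    LinearMap.ker (bbl d a p q) = LinearMap.ker (matPolyAct d (bblPoly d a p q)) := by
  rw [bbl_eq, End.mul_eq_comp,
    LinearMap.ker_comp_of_ker_eq_bot _ (LinearMap.ker_eq_bot.2 (shiftBy_injective d p))]

lemma eval_det_bblPoly (d : ℕ) (a : ℤ → Matrix (Fin d) (Fin d) ℂ) (p q : ℤ) {z : ℂ}
    (hz : z ≠ 0) :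
    (bblPoly d a p q).det.eval z = z ^ (-((d : ℤ) * p)) * (symbolEval d a p q z).det := by
  have h : (bblPoly d a p q).map (eval z) = z ^ (-p) • symbolEval d a p q z := by
    ext i j
    simp only [bblPoly, symbolEval, Matrix.map_apply, Matrix.sum_apply, Matrix.smul_apply,
      eval_finsetSum, smul_eq_mul, eval_mul, eval_pow, eval_X, eval_C, Finset.mul_sum]
    refine Finset.sum_congr rfl fun r hr => ?_
    rw [Finset.mem_Icc] at hr
    rw [← mul_assoc, ← zpow_add₀ hz, ← zpow_natCast, Int.toNat_of_nonneg (by omega)]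
    congr 2
    ring
  rw [eval_det, matPolyEquiv_eval_eq_map, h, Matrix.det_smul, Fintype.card_fin, ← zpow_natCast,
    ← zpow_mul]
  congr 2
  ring

lemma det_bblPoly_eq {d : ℕ} {a : ℤ → Matrix (Fin d) (Fin d) ℂ} {p q : ℤ} {P : ℂ[X]}
    (hP : ∀ z : ℂ, z ≠ 0 → P.eval z = z ^ (-((d : ℤ) * p)) * (symbolEval d a p q z).det) :
    (bblPoly d a p q).det = P := by
  refine eq_of_infinite_eval_eq _ _ (((Set.finite_singleton (0 : ℂ)).infinite_compl).mono ?_)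
  intro z hz
  rw [Set.mem_ofPred_eq, eval_det_bblPoly d a p q hz, hP z hz]

lemma ker_matPolyAct_inf_Tspace {d : ℕ} {z : ℂ} (hz : z ≠ 0) (A : Matrix (Fin d) (Fin d) ℂ[X])
    (hA : A.det ≠ 0) :
    LinearMap.ker (matPolyAct d A) ⊓ Tspace d z (A.det.rootMultiplicity z) =
      LinearMap.ker (matPolyAct d A) ⊓ (shiftBy d 1).maxGenEigenspace z := by
  refine le_antisymm (inf_le_inf_left _ (Tspace_le_maxGenEigenspace hz _)) ?_
  rintro Ψ ⟨hΨ, hΨz⟩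
  refine ⟨hΨ, ?_⟩
  obtain ⟨Q, hQ, hdvd⟩ := exists_eq_pow_rootMultiplicity_mul_and_not_dvd A.det hA z
  have hQz : Q.eval z ≠ 0 := by rwa [dvd_iff_isRoot] at hdvd
  have h0 : aeval (shiftBy d 1) A.det Ψ = 0 := ker_matPolyAct_le_ker_aeval_det d A hΨ
  rw [hQ, mul_comm, map_mul, End.mul_apply] at h0
  have h1 := eq_zero_of_aeval_eq_zero _ hQz (aeval_mem_maxGenEigenspace _ _ z hΨz) h0
  rw [map_pow, aeval_X_sub_C_shiftBy] at h1
  rw [SetLike.mem_coe, Tspace_eq_ker_pow hz]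
  exact h1

lemma ker_matPolyAct_le {d : ℕ} (A : Matrix (Fin d) (Fin d) ℂ[X]) (hA : A.det ≠ 0)
    {S : Submodule ℂ (SeqSp d)}
    (hS : ∀ z : ℂ, z ≠ 0 → A.det.IsRoot z →
      LinearMap.ker (matPolyAct d A) ⊓ Tspace d z (A.det.rootMultiplicity z) ≤ S) :
    LinearMap.ker (matPolyAct d A) ≤ S := by
  classical
  have hN : ∀ g : ℂ[X], ∀ Ψ ∈ LinearMap.ker (matPolyAct d A),
      aeval (shiftBy d 1) g Ψ ∈ LinearMap.ker (matPolyAct d A) := by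
    intro g Ψ hΨ
    rw [LinearMap.mem_ker] at hΨ ⊢
    rw [← End.mul_apply, ← (commute_aeval_matPolyAct d g A).eq, End.mul_apply, hΨ, map_zero]
  have hprod := inf_ker_aeval_prod_le (shiftBy d 1) _ S hN A.det.roots.toFinset
    (fun z => (X - C z) ^ A.det.rootMultiplicity z)
    (fun x _ y _ hxy => (isCoprime_X_sub_C_of_isUnit_sub (sub_ne_zero.2 hxy).isUnit).pow)
    (fun z hz => by
      rw [Multiset.mem_toFinset, mem_roots hA] at hz
      rw [map_pow, aeval_X_sub_C_shiftBy]
      by_cases hz0 : z = 0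
      · have hinj : Function.Injective ⇑(shiftBy d 1 ^ A.det.rootMultiplicity z) := by
          rw [shiftBy_pow]; exact shiftBy_injective d _
        rw [hz0, zero_smul, sub_zero, ← hz0, LinearMap.ker_eq_bot.2 hinj, inf_bot_eq]
        exact bot_le
      · rw [← Tspace_eq_ker_pow hz0]
        exact hS z hz0 hz)
  refine fun Ψ hΨ => hprod ⟨hΨ, ?_⟩
  have h0 : aeval (shiftBy d 1) A.det Ψ = 0 := ker_matPolyAct_le_ker_aeval_det d A hΨ
  rw [(IsAlgClosed.splits A.det).eq_prod_roots, prod_multiset_root_eq_finset_root, map_mul,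
    aeval_C, End.mul_apply, Module.algebraMap_end_apply] at h0
  exact (smul_eq_zero.1 h0).resolve_left (leadingCoeff_ne_zero.2 hA)

theorem stmt_9 (d : ℕ) (hd : 1 ≤ d) (p q : ℤ) (hpq : p ≤ q)
    (a : ℤ → Matrix (Fin d) (Fin d) ℂ) (hap : a p ≠ 0) (haq : a q ≠ 0)
    (hreg : (symbol d a p q).det ≠ 0)
    (P : Polynomial ℂ) (hP0 : P ≠ 0)
    (hP : ∀ z : ℂ, z ≠ 0 → P.eval z = z ^ (-((d : ℤ) * p)) * (symbolEval d a p q z).det)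
    (n : ℕ) (z : Fin n → ℂ) (hz0 : ∀ ℓ, z ℓ ≠ 0) (hzinj : Function.Injective z)
    (hroot : ∀ ℓ, P.IsRoot (z ℓ))
    (hall : ∀ w : ℂ, w ≠ 0 → P.IsRoot w → ∃ ℓ, z ℓ = w)
    (s : Fin n → ℕ) (hs : ∀ ℓ, s ℓ = P.rootMultiplicity (z ℓ)) :
    (LinearMap.ker (bbl d a p q)
        = ⨆ ℓ : Fin n, LinearMap.ker (bbl d a p q) ⊓ Tspace d (z ℓ) (s ℓ)) ∧
    iSupIndep (fun ℓ : Fin n => LinearMap.ker (bbl d a p q) ⊓ Tspace d (z ℓ) (s ℓ)) ∧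
    (∀ ℓ : Fin n,
      Module.finrank ℂ ↥(LinearMap.ker (bbl d a p q) ⊓ Tspace d (z ℓ) (s ℓ)) = s ℓ) ∧
    Module.finrank ℂ ↥(LinearMap.ker (bbl d a p q)) = ∑ ℓ : Fin n, s ℓ := by
  have hdet := det_bblPoly_eq hP
  have hA : (bblPoly d a p q).det ≠ 0 := hdet ▸ hP0
  have hT : ∀ ℓ, LinearMap.ker (bbl d a p q) ⊓ Tspace d (z ℓ) (s ℓ) =
      LinearMap.ker (matPolyAct d (bblPoly d a p q)) ⊓ (shiftBy d 1).maxGenEigenspace (z ℓ) := by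
    intro ℓ
    rw [← ker_matPolyAct_inf_Tspace (hz0 ℓ) _ hA, hdet, ← hs, ker_bbl]
  have hrank : ∀ ℓ, Module.rank ℂ ↥(LinearMap.ker (bbl d a p q) ⊓ Tspace d (z ℓ) (s ℓ)) =
      (s ℓ : ℕ) := by
    intro ℓ
    rw [hT, rank_ker_matPolyAct_inf (hz0 ℓ) _ hA, hdet, hs]
  have hfinrank : ∀ ℓ, finrank ℂ ↥(LinearMap.ker (bbl d a p q) ⊓ Tspace d (z ℓ) (s ℓ)) = s ℓ :=
    fun ℓ => finrank_eq_of_rank_eq (hrank ℓ)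
  have hfin : ∀ ℓ, Module.Finite ℂ ↥(LinearMap.ker (bbl d a p q) ⊓ Tspace d (z ℓ) (s ℓ)) := by
    intro ℓ
    rw [← rank_lt_aleph0_iff, hrank]
    exact Cardinal.natCast_lt_aleph0
  have hind : iSupIndep fun ℓ : Fin n => LinearMap.ker (bbl d a p q) ⊓ Tspace d (z ℓ) (s ℓ) :=
    ((shiftBy d 1).independent_maxGenEigenspace.comp hzinj).mono fun ℓ =>
      (hT ℓ).le.trans inf_le_right
  have hsup : LinearMap.ker (bbl d a p q) =
      ⨆ ℓ : Fin n, LinearMap.ker (bbl d a p q) ⊓ Tspace d (z ℓ) (s ℓ) := by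
    refine le_antisymm ?_ (iSup_le fun ℓ => inf_le_left)
    nth_rw 1 [ker_bbl]
    refine ker_matPolyAct_le _ hA fun w hw hroot => ?_
    rw [hdet] at hroot ⊢
    obtain ⟨ℓ, rfl⟩ := hall w hw hroot
    rw [← hs, ← ker_bbl]
    exact le_iSup (fun ℓ : Fin n => LinearMap.ker (bbl d a p q) ⊓ Tspace d (z ℓ) (s ℓ)) ℓ
  refine ⟨hsup, hind, hfinrank, ?_⟩
  rw [hsup, finrank_iSup_eq_sum _ hind]
  exact Finset.sum_congr rfl fun ℓ _ => hfinrank ℓ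

end
end
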